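/- arXiv:1211.6631 — 2 statements merged into one kernel-verified Lean document; each statement's English description precedes it below -/
import Mathlib

section
/- Let S, S' ⊆ ℂ be finite nonempty sets and let N₀, N₀' > 0 be real numbers with (S, N₀) ≠ (S', N₀'). Then klDiv(P_{S,N₀}, P_{S',N₀'}) > 0. -/
open Real MeasureTheory ProbabilityTheory Filter

/-- The equal-weight homoscedastic complex Gaussian mixture density
`f_{S,N₀}(r) = (1/|S|) · Σ_{μ ∈ S} (1/(π N₀)) · exp(−|r − μ|²/N₀)`. -/
noncomputable def mixDensity (S : Finset ℂ) (N₀ : ℝ) (r : ℂ) : ℝ :=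
  (S.card : ℝ)⁻¹ * ∑ μ ∈ S, (π * N₀)⁻¹ * Real.exp (-(‖r - μ‖) ^ 2 / N₀)

/-- The probability measure `P_{S,N₀}` on `ℂ` with density `f_{S,N₀}` w.r.t. Lebesgue measure. -/
noncomputable def mixMeasure (S : Finset ℂ) (N₀ : ℝ) : Measure ℂ :=
  volume.withDensity fun r => ENNReal.ofReal (mixDensity S N₀ r)

/-- Kullback–Leibler divergence `∫ log (dP/dQ) dP` of measures (`⊤` if `P` is not absolutely
continuous w.r.t. `Q` or the log-likelihood ratio is not integrable). -/
noncomputable def klDiv {α : Type*} [MeasurableSpace α] (P Q : Measure α) : EReal := by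
  classical
  exact if P ≪ Q ∧ Integrable (llr P Q) P then ((∫ x, llr P Q x ∂P : ℝ) : EReal) else ⊤

lemma mix_integral (μ : ℂ) (N : ℝ) (hN : 0 < N) :
    ∫ r : ℂ, Real.exp (-(‖r - μ‖) ^ 2 / N) = π * N := by
  rw [integral_sub_right_eq_self (fun r : ℂ => Real.exp (-(‖r‖) ^ 2 / N)) μ]
  have h := GaussianFourier.integral_rexp_neg_mul_sq_norm (V := ℂ) (b := 1 / N) (by positivity)
  rw [Complex.finrank_real_complex] at h
  have e : (fun r : ℂ => Real.exp (-(‖r‖) ^ 2 / N)) = fun r : ℂ => Real.exp (-(1 / N) * ‖r‖ ^ 2) := by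
    funext r; congr 1; ring
  rw [e, h]
  norm_num

lemma mix_integrable (μ : ℂ) (N : ℝ) (hN : 0 < N) :
    Integrable (fun r : ℂ => Real.exp (-(‖r - μ‖) ^ 2 / N)) := by
  by_contra h
  have h1 := mix_integral μ N hN
  rw [integral_undef h] at h1
  have : 0 < π * N := by positivity
  linarith

lemma mix_nonneg (S : Finset ℂ) (N : ℝ) (hN : 0 < N) (r : ℂ) : 0 ≤ mixDensity S N r := by
  unfold mixDensity
  positivity

lemma mix_cont (S : Finset ℂ) (N : ℝ) : Continuous (mixDensity S N) := by
  unfold mixDensity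
  fun_prop

lemma mix_prob (S : Finset ℂ) (hS : S.Nonempty) (N : ℝ) (hN : 0 < N) :
    IsProbabilityMeasure (mixMeasure S N) := by
  constructor
  have hint : Integrable (mixDensity S N) := by
    unfold mixDensity
    exact (integrable_finsetSum _ fun μ _ => (mix_integrable μ N hN).const_mul _).const_mul _
  rw [mixMeasure, withDensity_apply _ MeasurableSet.univ, Measure.restrict_univ,
    ← ofReal_integral_eq_lintegral_ofReal hint (ae_of_all _ (mix_nonneg S N hN))]
  have : ∫ r, mixDensity S N r = 1 := by
    unfold mixDensity
    rw [integral_const_mul, integral_finsetSum _ fun μ _ => (mix_integrable μ N hN).const_mul _]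
    simp_rw [integral_const_mul, mix_integral _ N hN]
    have h1 : (S.card : ℝ) ≠ 0 := by exact_mod_cast hS.card_pos.ne'
    have h2 : π * N ≠ 0 := by positivity
    rw [inv_mul_cancel₀ h2]
    simp [h1]
  rw [this]; simp

lemma mix_tendsto (μ ν : ℂ) (N N' : ℝ) (hN : 0 < N) (h : N < N') :
    Tendsto (fun t : ℝ => Real.exp (-(‖(t : ℂ) - μ‖) ^ 2 / N) * Real.exp ((‖(t : ℂ) - ν‖) ^ 2 / N'))
      atTop (nhds 0) := by
  have hN' : 0 < N' := hN.trans h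
  have hsq : ∀ (t : ℝ) (z : ℂ), ‖(t : ℂ) - z‖ ^ 2 = (t - z.re) ^ 2 + z.im ^ 2 := by
    intro t z
    rw [← Complex.normSq_eq_norm_sq, Complex.normSq_apply]
    simp; ring
  simp_rw [← Real.exp_add, hsq]
  refine Real.tendsto_exp_atBot.comp ?_
  have hc : 1 / N' - 1 / N < 0 := by
    have := one_div_lt_one_div_of_lt hN h
    linarith
  have key : Tendsto (fun t : ℝ => t * ((1 / N' - 1 / N) * t + (2 * μ.re / N - 2 * ν.re / N')))
      atTop atBot := by
    apply tendsto_id.atTop_mul_atBot₀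
    exact tendsto_atBot_add_const_right _ _ (tendsto_id.const_mul_atTop_of_neg hc)
  refine (tendsto_atBot_add_const_right _
    (-(μ.re ^ 2 + μ.im ^ 2) / N + (ν.re ^ 2 + ν.im ^ 2) / N') key).congr ?_
  intro t
  ring

lemma mix_N_le (S S' : Finset ℂ) (hS' : S'.Nonempty) (N N' : ℝ) (hN : 0 < N) (hN' : 0 < N')
    (h : mixDensity S N = mixDensity S' N') : N' ≤ N := by
  by_contra! hlt
  obtain ⟨ν, hν⟩ := hS'
  have hT : Tendsto (fun t : ℝ => mixDensity S N t * Real.exp ((‖(t : ℂ) - ν‖) ^ 2 / N'))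
      atTop (nhds 0) := by
    have := (tendsto_finsetSum S fun μ _ =>
      (mix_tendsto μ ν N N' hN hlt).const_mul (π * N)⁻¹).const_mul (S.card : ℝ)⁻¹
    simp only [mul_zero, Finset.sum_const_zero] at this
    refine this.congr fun t => ?_
    rw [mixDensity, mul_assoc, Finset.sum_mul]
    simp_rw [mul_assoc]
  have hc : 0 < (S'.card : ℝ)⁻¹ * (π * N')⁻¹ := by
    have : 0 < (S'.card : ℝ) := by exact_mod_cast Finset.card_pos.2 ⟨ν, hν⟩
    positivity
  have := ge_of_tendsto' hT (b := (S'.card : ℝ)⁻¹ * (π * N')⁻¹) ?_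
  · linarith
  intro t
  rw [h, mixDensity, mul_assoc]
  gcongr
  rw [Finset.sum_mul]
  refine le_trans (le_of_eq ?_) (Finset.single_le_sum (fun i _ => by positivity) hν)
  rw [mul_assoc, ← Real.exp_add]
  have : -‖(t : ℂ) - ν‖ ^ 2 / N' + ‖(t : ℂ) - ν‖ ^ 2 / N' = 0 := by ring
  rw [this]; simp

/-- The character `r ↦ exp (2⟨r, μ⟩/N)`. -/
noncomputable def mixChar (N : ℝ) (μ : ℂ) : Multiplicative ℂ →* ℝ where
  toFun r := Real.exp (2 * ((r.toAdd).re * μ.re + (r.toAdd).im * μ.im) / N)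
  map_one' := by simp
  map_mul' x y := by
    rw [← Real.exp_add]; congr 1
    simp; ring

lemma mixChar_inj (N : ℝ) (hN : 0 < N) : Function.Injective (mixChar N) := by
  intro μ ν h
  have h1 := DFunLike.congr_fun h (Multiplicative.ofAdd (1 : ℂ))
  have h2 := DFunLike.congr_fun h (Multiplicative.ofAdd Complex.I)
  simp [mixChar, hN.ne'] at h1 h2
  exact Complex.ext h1 h2

lemma mix_sum (S : Finset ℂ) (N : ℝ) (r : ℂ) : mixDensity S N r * Real.exp (‖r‖ ^ 2 / N) =
    ∑ μ ∈ S, ((S.card : ℝ)⁻¹ * (π * N)⁻¹ * Real.exp (-‖μ‖ ^ 2 / N)) *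
      mixChar N μ (Multiplicative.ofAdd r) := by
  rw [mixDensity, mul_assoc, Finset.sum_mul, Finset.mul_sum]
  refine Finset.sum_congr rfl fun μ _ => ?_
  simp only [mixChar, MonoidHom.coe_mk, OneHom.coe_mk, toAdd_ofAdd]
  simp only [mul_assoc]
  rw [← Real.exp_add, ← Real.exp_add]
  congr 3
  simp only [← Complex.normSq_eq_norm_sq, Complex.normSq_apply]
  simp; ring

lemma mix_subset (S S' : Finset ℂ) (N : ℝ) (hN : 0 < N)
    (h : mixDensity S N = mixDensity S' N) : S ⊆ S' := by
  classical
  intro ν hν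
  by_contra hν'
  have hli : LinearIndependent ℝ fun μ : ℂ => (mixChar N μ : Multiplicative ℂ → ℝ) :=
    (linearIndependent_monoidHom (Multiplicative ℂ) ℝ).comp _ (mixChar_inj N hN)
  let c (T : Finset ℂ) (μ : ℂ) : ℝ :=
    if μ ∈ T then (T.card : ℝ)⁻¹ * (π * N)⁻¹ * Real.exp (-‖μ‖ ^ 2 / N) else 0
  have hsum : ∀ (T : Finset ℂ) (r : ℂ), T ⊆ S ∪ S' →
      mixDensity T N r * Real.exp (‖r‖ ^ 2 / N) =
      ∑ μ ∈ S ∪ S', c T μ * mixChar N μ (Multiplicative.ofAdd r) := by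
    intro T r hT
    rw [mix_sum, ← Finset.sum_subset hT]
    · refine Finset.sum_congr rfl fun μ hμ => ?_
      simp [c, hμ]
    · intro x _ hx
      simp [c, hx]
  have h0 := linearIndependent_iff'.1 hli (S ∪ S') (fun μ => c S μ - c S' μ) (by
    funext r
    have e := hsum S r.toAdd Finset.subset_union_left
    rw [h, hsum S' r.toAdd Finset.subset_union_right] at e
    simp only [ofAdd_toAdd] at e
    simp only [Finset.sum_apply, Pi.smul_apply, smul_eq_mul, sub_mul, Finset.sum_sub_distrib,
      Pi.zero_apply]
    linarith) ν (Finset.mem_union_left _ hν)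
  have : 0 < (S.card : ℝ) := by exact_mod_cast Finset.card_pos.2 ⟨ν, hν⟩
  have hp : 0 < (S.card : ℝ)⁻¹ * (π * N)⁻¹ * Real.exp (-‖ν‖ ^ 2 / N) := by positivity
  simp only [c, hν, hν', if_true, if_false] at h0
  linarith

lemma mix_ident (S S' : Finset ℂ) (hS : S.Nonempty) (hS' : S'.Nonempty)
    (N N' : ℝ) (hN : 0 < N) (hN' : 0 < N') (h : mixMeasure S N = mixMeasure S' N') :
    (S, N) = (S', N') := by
  have := mix_prob S hS N hN
  have hd : mixDensity S N = mixDensity S' N' := by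
    have h1 : (fun r => ENNReal.ofReal (mixDensity S N r)) =ᵐ[volume]
        fun r => ENNReal.ofReal (mixDensity S' N' r) := by
      refine (withDensity_eq_iff_of_sigmaFinite ?_ ?_).1 h
      · exact (mix_cont S N).measurable.ennreal_ofReal.aemeasurable
      · exact (mix_cont S' N').measurable.ennreal_ofReal.aemeasurable
    refine (Continuous.ae_eq_iff_eq volume (mix_cont S N) (mix_cont S' N')).1 ?_
    filter_upwards [h1] with r hr
    exact (ENNReal.ofReal_eq_ofReal_iff (mix_nonneg S N hN r) (mix_nonneg S' N' hN' r)).1 hr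
  have hNN : N = N' := le_antisymm (mix_N_le S' S hS N' N hN' hN hd.symm)
    (mix_N_le S S' hS' N N' hN hN' hd)
  subst hNN
  rw [(mix_subset S S' N hN hd).antisymm (mix_subset S' S N hN hd.symm)]

/-- Distinct equal-weight homoscedastic complex Gaussian mixtures are at
positive Kullback–Leibler distance. -/
theorem klDiv_mixMeasure_pos (S S' : Finset ℂ) (hS : S.Nonempty) (hS' : S'.Nonempty)
    (N₀ N₀' : ℝ) (hN₀ : 0 < N₀) (hN₀' : 0 < N₀')
    (hne : (S, N₀) ≠ (S', N₀')) :
    0 < klDiv (mixMeasure S N₀) (mixMeasure S' N₀') := by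
  have := mix_prob S hS N₀ hN₀
  have := mix_prob S' hS' N₀' hN₀'
  unfold klDiv
  split_ifs with h
  · rw [← InformationTheory.toReal_klDiv_of_measure_eq h.1 (by simp)]
    have hp := ENNReal.toReal_pos
      (fun h0 => hne (mix_ident S S' hS hS' N₀ N₀' hN₀ hN₀' (InformationTheory.klDiv_eq_zero_iff.1 h0)))
      (InformationTheory.klDiv_ne_top h.1 h.2)
    exact_mod_cast hp
  · simp
end

section
/- Let S_1,…,S_K ⊆ ℂ be pairwise distinct finite nonempty constellation sets, let N₀ > 0, fix i ∈ {1,…,K}, and let (r_n)_{n≥1} be an i.i.d. sequence of ℂ-valued random variables with law P_{S_i,N₀}. Then almost surely there exists N* such that for every N ≥ N* and every j ≠ i, Σ_{n=1}^{N} log f_{S_i,N₀}(r_n) > Σ_{n=1}^{N} log f_{S_j,N₀}(r_n); that is, the maximum-likelihood classifier based on the first N observations selects modulation i for all sufficiently large N. (Theorem 1, almost-sure form: the ML classifier asymptotically attains zero probability of error for classifying digital amplitude-phase modulations regardless of the received SNR.) -/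
open Real MeasureTheory ProbabilityTheory Filter

lemma aux_gauss_integral {b : ℝ} (hb : 0 < b) (μ : ℂ) :
    ∫ r : ℂ, Real.exp (-b * ‖r - μ‖ ^ 2) = π / b := by
  rw [integral_sub_right_eq_self (fun r : ℂ => Real.exp (-b * ‖r‖ ^ 2)) μ,
    GaussianFourier.integral_rexp_neg_mul_sq_norm hb]
  simp

lemma aux_gauss_integrable {b : ℝ} (hb : 0 < b) (μ : ℂ) :
    Integrable (fun r : ℂ => Real.exp (-b * ‖r - μ‖ ^ 2)) := by
  by_contra h
  have h1 := aux_gauss_integral hb μ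
  rw [integral_undef h] at h1
  have : 0 < π / b := by positivity
  linarith

lemma aux_exp_eq (N₀ : ℝ) (r μ : ℂ) :
    Real.exp (-(‖r - μ‖) ^ 2 / N₀) = Real.exp (-N₀⁻¹ * ‖r - μ‖ ^ 2) := by
  congr 1
  ring

lemma aux_cont (S : Finset ℂ) (N₀ : ℝ) : Continuous (mixDensity S N₀) := by
  unfold mixDensity
  fun_prop

lemma aux_pos {S : Finset ℂ} (hS : S.Nonempty) {N₀ : ℝ} (h : 0 < N₀) (r : ℂ) :
    0 < mixDensity S N₀ r := by
  unfold mixDensity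
  have : 0 < (S.card : ℝ) := by exact_mod_cast hS.card_pos
  have h2 : 0 < ∑ μ ∈ S, (π * N₀)⁻¹ * Real.exp (-(‖r - μ‖) ^ 2 / N₀) :=
    Finset.sum_pos (fun μ _ => by positivity) hS
  positivity

lemma aux_integrable (S : Finset ℂ) {N₀ : ℝ} (h : 0 < N₀) :
    Integrable (mixDensity S N₀) := by
  unfold mixDensity
  refine Integrable.const_mul (integrable_finsetSum _ fun μ _ => Integrable.const_mul ?_ _) _
  simp_rw [aux_exp_eq]
  exact aux_gauss_integrable (inv_pos.2 h) μ

lemma aux_integral {S : Finset ℂ} (hS : S.Nonempty) {N₀ : ℝ} (h : 0 < N₀) :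
    ∫ r, mixDensity S N₀ r = 1 := by
  unfold mixDensity
  simp_rw [aux_exp_eq]
  rw [integral_const_mul, integral_finsetSum _ fun μ _ =>
    Integrable.const_mul (aux_gauss_integrable (inv_pos.2 h) μ) _]
  simp_rw [integral_const_mul, aux_gauss_integral (inv_pos.2 h)]
  have : (S.card : ℝ) ≠ 0 := by exact_mod_cast hS.card_pos.ne'
  have := pi_ne_zero
  simp
  field_simp

lemma aux_log_cont {S : Finset ℂ} (hS : S.Nonempty) {N₀ : ℝ} (h : 0 < N₀) :
    Continuous (fun r => Real.log (mixDensity S N₀ r)) :=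
  (aux_cont S N₀).log fun r => (aux_pos hS h r).ne'

lemma aux_log_bound {S : Finset ℂ} (hS : S.Nonempty) {N₀ : ℝ} (h : 0 < N₀) :
    ∃ C : ℝ, 0 ≤ C ∧ ∃ ν : ℂ, ∀ r, |Real.log (mixDensity S N₀ r)| ≤ C + N₀⁻¹ * ‖r - ν‖ ^ 2 := by
  obtain ⟨ν, hν⟩ := hS
  have hc : 0 < (S.card : ℝ) := by exact_mod_cast Finset.card_pos.2 ⟨ν, hν⟩
  refine ⟨|Real.log ((π * N₀)⁻¹)| + |Real.log ((S.card : ℝ)⁻¹ * (π * N₀)⁻¹)|, by positivity, ν,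
    fun r => ?_⟩
  have hu : mixDensity S N₀ r ≤ (π * N₀)⁻¹ := by
    unfold mixDensity
    have : ∑ μ ∈ S, (π * N₀)⁻¹ * Real.exp (-(‖r - μ‖) ^ 2 / N₀) ≤ ∑ μ ∈ S, (π * N₀)⁻¹ := by
      refine Finset.sum_le_sum fun μ _ => ?_
      refine mul_le_of_le_one_right (by positivity) (Real.exp_le_one_iff.2 ?_)
      rw [neg_div]
      exact neg_nonpos.2 (by positivity)
    calc _ ≤ (S.card : ℝ)⁻¹ * ∑ μ ∈ S, (π * N₀)⁻¹ := by gcongr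
      _ = _ := by simp; field_simp
  have hl : (S.card : ℝ)⁻¹ * (π * N₀)⁻¹ * Real.exp (-N₀⁻¹ * ‖r - ν‖ ^ 2) ≤ mixDensity S N₀ r := by
    unfold mixDensity
    rw [mul_assoc, ← aux_exp_eq]
    gcongr
    exact Finset.single_le_sum (f := fun μ => (π * N₀)⁻¹ * Real.exp (-(‖r - μ‖) ^ 2 / N₀))
      (fun μ _ => by positivity) hν
  have hp := aux_pos ⟨ν, hν⟩ h r
  have h1 := Real.log_le_log hp hu
  have h2 := Real.log_le_log (by positivity) hl
  rw [Real.log_mul (by positivity) (by positivity), Real.log_exp] at h2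
  have h3 : 0 ≤ N₀⁻¹ * ‖r - ν‖ ^ 2 := by positivity
  have h4 := le_abs_self (Real.log ((π * N₀)⁻¹))
  have h5 := neg_abs_le (Real.log ((S.card : ℝ)⁻¹ * (π * N₀)⁻¹))
  have h6 := abs_nonneg (Real.log ((π * N₀)⁻¹))
  have h7 := abs_nonneg (Real.log ((S.card : ℝ)⁻¹ * (π * N₀)⁻¹))
  rw [abs_le]
  constructor <;> linarith

lemma aux_int_one {T : Finset ℂ} (hT : T.Nonempty) {N₀ : ℝ} (h : 0 < N₀) (μ : ℂ) :
    Integrable (fun r => Real.exp (-(‖r - μ‖) ^ 2 / N₀) * Real.log (mixDensity T N₀ r)) := by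
  obtain ⟨C, hC, ν, hb⟩ := aux_log_bound hT h
  have hb2 : 0 < N₀⁻¹ / 2 := by positivity
  refine Integrable.mono'
    ((aux_gauss_integrable hb2 μ).const_mul (C + N₀⁻¹ * 2 * ‖μ - ν‖ ^ 2 + 4)) ?_ ?_
  · have := aux_log_cont hT h
    exact Continuous.aestronglyMeasurable (by fun_prop)
  · refine Eventually.of_forall fun r => ?_
    rw [norm_mul, Real.norm_of_nonneg (Real.exp_pos _).le, Real.norm_eq_abs, aux_exp_eq]
    set t := N₀⁻¹ / 2 * ‖r - μ‖ ^ 2 with ht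
    have ht0 : 0 ≤ t := by positivity
    have e1 : -N₀⁻¹ * ‖r - μ‖ ^ 2 = -t + -t := by rw [ht]; ring
    have e2 : -(N₀⁻¹ / 2) * ‖r - μ‖ ^ 2 = -t := by rw [ht]; ring
    rw [e1, e2, Real.exp_add]
    have h1 : ‖r - ν‖ ^ 2 ≤ 2 * ‖r - μ‖ ^ 2 + 2 * ‖μ - ν‖ ^ 2 := by
      have := norm_sub_le_norm_sub_add_norm_sub r μ ν
      have h0 := norm_nonneg (r - ν)
      nlinarith [sq_nonneg (‖r - μ‖ - ‖μ - ν‖)]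
    have h2 : |Real.log (mixDensity T N₀ r)| ≤ (C + N₀⁻¹ * 2 * ‖μ - ν‖ ^ 2) + 4 * t := by
      refine (hb r).trans ?_
      have := mul_le_mul_of_nonneg_left h1 (inv_pos.2 h).le
      rw [ht]; linarith
    have hA : 0 ≤ C + N₀⁻¹ * 2 * ‖μ - ν‖ ^ 2 := by positivity
    have h3 : Real.exp (-t) * t ≤ 1 := by
      have := Real.add_one_le_exp t
      rw [Real.exp_neg, inv_mul_le_iff₀ (Real.exp_pos _)]
      linarith
    have h4 : Real.exp (-t) ≤ 1 := Real.exp_le_one_iff.2 (by linarith)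
    have h5 : Real.exp (-t) * |Real.log (mixDensity T N₀ r)|
        ≤ C + N₀⁻¹ * 2 * ‖μ - ν‖ ^ 2 + 4 := by
      have := mul_le_mul_of_nonneg_left h2 (Real.exp_pos (-t)).le
      have := mul_le_mul_of_nonneg_right h4 hA
      linarith
    have := mul_le_mul_of_nonneg_left h5 (Real.exp_pos (-t)).le
    linarith

lemma aux_int_log (S : Finset ℂ) {T : Finset ℂ} (hT : T.Nonempty) {N₀ : ℝ}
    (h : 0 < N₀) :
    Integrable (fun r => mixDensity S N₀ r * Real.log (mixDensity T N₀ r)) := by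
  have : (fun r => mixDensity S N₀ r * Real.log (mixDensity T N₀ r)) = fun r =>
      (S.card : ℝ)⁻¹ * ∑ μ ∈ S, (π * N₀)⁻¹ *
        (Real.exp (-(‖r - μ‖) ^ 2 / N₀) * Real.log (mixDensity T N₀ r)) := by
    ext r
    conv_lhs => rw [mixDensity]
    rw [mul_assoc, Finset.sum_mul]
    simp_rw [mul_assoc]
  rw [this]
  exact Integrable.const_mul
    (integrable_finsetSum _ fun μ _ => Integrable.const_mul (aux_int_one hT h μ) _) _

/-- the exponential characters -/
noncomputable def auxChi (N₀ : ℝ) (μ : ℂ) : Multiplicative ℂ →* ℝ where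
  toFun r := Real.exp (2 * (r.toAdd.re * μ.re + r.toAdd.im * μ.im) / N₀)
  map_one' := by simp
  map_mul' x y := by
    rw [← Real.exp_add]
    congr 1
    simp only [toAdd_mul, Complex.add_re, Complex.add_im]
    ring

lemma auxChi_inj {N₀ : ℝ} (h : 0 < N₀) : Function.Injective (auxChi N₀) := by
  intro μ ν hμ
  have h1 := DFunLike.congr_fun hμ (Multiplicative.ofAdd 1)
  have h2 := DFunLike.congr_fun hμ (Multiplicative.ofAdd Complex.I)
  simp only [auxChi, MonoidHom.coe_mk, OneHom.coe_mk, toAdd_ofAdd, Real.exp_eq_exp] at h1 h2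
  have := h.ne'
  simp at h1 h2
  field_simp at h1 h2
  exact Complex.ext h1 h2

lemma aux_dens_eq (S U : Finset ℂ) (hSU : S ⊆ U) (N₀ : ℝ) (r : ℂ) :
    mixDensity S N₀ r = ((π * N₀)⁻¹ * Real.exp (-‖r‖ ^ 2 / N₀)) *
      ∑ μ ∈ U, (if μ ∈ S then (S.card : ℝ)⁻¹ else 0) * Real.exp (-‖μ‖ ^ 2 / N₀) *
        auxChi N₀ μ (Multiplicative.ofAdd r) := by
  unfold mixDensity
  rw [Finset.mul_sum, Finset.mul_sum, ← Finset.sum_subset hSU]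
  · refine Finset.sum_congr rfl fun μ hμ => ?_
    have : Real.exp (-(‖r - μ‖) ^ 2 / N₀) = Real.exp (-‖r‖ ^ 2 / N₀) *
        Real.exp (-‖μ‖ ^ 2 / N₀) * auxChi N₀ μ (Multiplicative.ofAdd r) := by
      simp only [auxChi, MonoidHom.coe_mk, OneHom.coe_mk, toAdd_ofAdd]
      rw [← Real.exp_add, ← Real.exp_add]
      congr 1
      simp only [Complex.sq_norm, Complex.normSq_apply, Complex.sub_re, Complex.sub_im]
      ring
    rw [this, if_pos hμ]
    ring
  · intro μ _ hμ
    simp [hμ]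

lemma aux_ident {S T : Finset ℂ} (hS : S.Nonempty) (hT : T.Nonempty) {N₀ : ℝ} (h : 0 < N₀)
    (heq : ∀ r, mixDensity S N₀ r = mixDensity T N₀ r) : S = T := by
  have hli := (linearIndependent_monoidHom (Multiplicative ℂ) ℝ).comp _ (auxChi_inj h)
  rw [linearIndependent_iff'] at hli
  have key := hli (S ∪ T) (fun μ => ((if μ ∈ S then (S.card : ℝ)⁻¹ else 0) -
    (if μ ∈ T then (T.card : ℝ)⁻¹ else 0)) * Real.exp (-‖μ‖ ^ 2 / N₀)) (by
      ext r
      have h1 := heq r.toAdd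
      rw [aux_dens_eq S (S ∪ T) Finset.subset_union_left,
        aux_dens_eq T (S ∪ T) Finset.subset_union_right] at h1
      have h2 := mul_left_cancel₀ (by have := pi_pos; positivity) h1
      rw [← sub_eq_zero, ← Finset.sum_sub_distrib] at h2
      simp only [Finset.sum_apply, Pi.smul_apply, Function.comp_apply, smul_eq_mul,
        Pi.zero_apply]
      refine Eq.trans ?_ h2
      refine Finset.sum_congr rfl fun μ _ => ?_
      rw [ofAdd_toAdd]
      ring)
  have hs : (S.card : ℝ)⁻¹ ≠ 0 := inv_ne_zero (by exact_mod_cast hS.card_pos.ne')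
  have ht : (T.card : ℝ)⁻¹ ≠ 0 := inv_ne_zero (by exact_mod_cast hT.card_pos.ne')
  ext μ
  constructor
  · intro hμ
    by_contra hn
    have := key μ (Finset.mem_union_left _ hμ)
    simp [hμ, hn] at this
    simp [this] at hμ
  · intro hμ
    by_contra hn
    have := key μ (Finset.mem_union_right _ hμ)
    simp [hμ, hn] at this
    simp [this] at hμ

lemma aux_gibbs {a b : ℝ} (ha : 0 < a) (hb : 0 < b) :
    0 ≤ a * Real.log a - a * Real.log b - (a - b) := by
  have h1 := Real.log_le_sub_one_of_pos (div_pos hb ha)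
  rw [Real.log_div hb.ne' ha.ne'] at h1
  have h2 := mul_le_mul_of_nonneg_left h1 ha.le
  have : a * (b / a - 1) = b - a := by field_simp
  linarith

lemma aux_gibbs_eq {a b : ℝ} (ha : 0 < a) (hb : 0 < b)
    (h : a * Real.log a - a * Real.log b - (a - b) = 0) : a = b := by
  by_contra hne
  have h1 := Real.log_lt_sub_one_of_pos (div_pos hb ha)
    (fun h => hne ((div_eq_one_iff_eq ha.ne').1 h).symm)
  rw [Real.log_div hb.ne' ha.ne'] at h1
  have h2 := mul_lt_mul_of_pos_left h1 ha
  have : a * (b / a - 1) = b - a := by field_simp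
  linarith

lemma aux_kl_pos {S T : Finset ℂ} (hS : S.Nonempty) (hT : T.Nonempty) (hne : S ≠ T)
    {N₀ : ℝ} (h : 0 < N₀) :
    0 < ∫ r, mixDensity S N₀ r * (Real.log (mixDensity S N₀ r) - Real.log (mixDensity T N₀ r)) := by
  set G : ℂ → ℝ := fun r => mixDensity S N₀ r * Real.log (mixDensity S N₀ r) -
    mixDensity S N₀ r * Real.log (mixDensity T N₀ r) - (mixDensity S N₀ r - mixDensity T N₀ r)
    with hG
  have i1 := aux_int_log S hS h
  have i2 := aux_int_log S hT h
  have i3 := aux_integrable S h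
  have i4 := aux_integrable T h
  have hGi : Integrable G := (i1.sub i2).sub (i3.sub i4)
  have hG0 : 0 ≤ G := fun r => aux_gibbs (aux_pos hS h r) (aux_pos hT h r)
  have hGint : ∫ r, G r = ∫ r, mixDensity S N₀ r *
      (Real.log (mixDensity S N₀ r) - Real.log (mixDensity T N₀ r)) := by
    simp_rw [mul_sub]
    have e1 := integral_sub (i1.sub i2) (i3.sub i4)
    have e2 := integral_sub i3 i4
    simp only [Pi.sub_apply] at e1
    rw [hG, e1, e2, aux_integral hS h, aux_integral hT h]
    simp
  rw [← hGint]
  refine lt_of_le_of_ne (integral_nonneg hG0) fun h0 => hne ?_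
  have hae := (integral_eq_zero_iff_of_nonneg hG0 hGi).1 h0.symm
  have hGc : Continuous G := by
    have := aux_log_cont hS h
    have := aux_log_cont hT h
    have := aux_cont S N₀
    have := aux_cont T N₀
    fun_prop
  have hz : G = 0 := (Continuous.ae_eq_iff_eq volume hGc continuous_zero).1 hae
  exact aux_ident hS hT h fun r =>
    aux_gibbs_eq (aux_pos hS h r) (aux_pos hT h r) (congrFun hz r)

/-- **Theorem 1, almost-sure form.** Under the true modulation `i`, almost surely
the ML classifier selects `i` for all sufficiently large sample sizes `N`. -/
theorem ml_classifier_eventually_correct {Ω : Type*} [MeasureSpace Ω]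
    [IsProbabilityMeasure (ℙ : Measure Ω)]
    (K : ℕ) (S : Fin K → Finset ℂ) (hne : ∀ k, (S k).Nonempty)
    (hdist : Function.Injective S)
    (N₀ : ℝ) (hN₀ : 0 < N₀) (i : Fin K)
    (r : ℕ → Ω → ℂ) (hmeas : ∀ n, Measurable (r n))
    (hindep : iIndepFun r ℙ)
    (hlaw : ∀ n, Measure.map (r n) ℙ = mixMeasure (S i) N₀) :
    ∀ᵐ ω ∂(ℙ : Measure Ω), ∃ Nstar : ℕ, ∀ N ≥ Nstar, ∀ j ≠ i,
      ∑ n ∈ Finset.range N, Real.log (mixDensity (S j) N₀ (r n ω)) <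
        ∑ n ∈ Finset.range N, Real.log (mixDensity (S i) N₀ (r n ω)) := by
  suffices hj : ∀ j, j ≠ i → ∀ᵐ ω ∂(ℙ : Measure Ω), ∀ᶠ N : ℕ in atTop,
      ∑ n ∈ Finset.range N, Real.log (mixDensity (S j) N₀ (r n ω)) <
        ∑ n ∈ Finset.range N, Real.log (mixDensity (S i) N₀ (r n ω)) by
    have h1 : ∀ᵐ ω ∂(ℙ : Measure Ω), ∀ j, j ≠ i → ∀ᶠ N : ℕ in atTop,
      ∑ n ∈ Finset.range N, Real.log (mixDensity (S j) N₀ (r n ω)) <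
        ∑ n ∈ Finset.range N, Real.log (mixDensity (S i) N₀ (r n ω)) := by
      rw [ae_all_iff]
      intro j
      by_cases h : j = i
      · simp [h]
      · simpa [h] using hj j h
    filter_upwards [h1] with ω hω
    have h2 : ∀ᶠ N : ℕ in atTop, ∀ j, j ≠ i → 
      ∑ n ∈ Finset.range N, Real.log (mixDensity (S j) N₀ (r n ω)) <
        ∑ n ∈ Finset.range N, Real.log (mixDensity (S i) N₀ (r n ω)) := by
      rw [eventually_all]
      intro j
      by_cases h : j = i
      · simp [h]
      · simpa [h] using hω j h
    exact eventually_atTop.1 h2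
  intro j hji
  have hSne : S i ≠ S j := fun h => hji (hdist h).symm
  set g : ℂ → ℝ := fun z => Real.log (mixDensity (S i) N₀ z) - Real.log (mixDensity (S j) N₀ z)
    with hg
  have hgc : Continuous g := (aux_log_cont (hne i) hN₀).sub (aux_log_cont (hne j) hN₀)
  have hdm : Measurable fun z => ENNReal.ofReal (mixDensity (S i) N₀ z) :=
    (aux_cont (S i) N₀).measurable.ennreal_ofReal
  have hlt : ∀ᵐ z ∂(volume : Measure ℂ), ENNReal.ofReal (mixDensity (S i) N₀ z) < ⊤ :=
    Eventually.of_forall fun z => ENNReal.ofReal_lt_top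
  have htr : ∀ z, (ENNReal.ofReal (mixDensity (S i) N₀ z)).toReal = mixDensity (S i) N₀ z :=
    fun z => ENNReal.toReal_ofReal (aux_pos (hne i) hN₀ z).le
  have hgi : Integrable g (mixMeasure (S i) N₀) := by
    unfold mixMeasure
    rw [integrable_withDensity_iff_integrable_smul' hdm hlt]
    simp_rw [htr, smul_eq_mul, hg, mul_sub]
    exact (aux_int_log _ (hne i) hN₀).sub (aux_int_log _ (hne j) hN₀)
  have hgpos : 0 < ∫ z, g z ∂(mixMeasure (S i) N₀) := by
    unfold mixMeasure
    rw [integral_withDensity_eq_integral_toReal_smul hdm hlt]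
    simp_rw [htr, smul_eq_mul]
    exact aux_kl_pos (hne i) (hne j) hSne hN₀
  have hid : ∀ n, IdentDistrib (r n) (r 0) ℙ ℙ := fun n =>
    ⟨(hmeas n).aemeasurable, (hmeas 0).aemeasurable, by rw [hlaw, hlaw]⟩
  have hslln := strong_law_ae_real (μ := (ℙ : Measure Ω)) (fun n ω => g (r n ω))
    (by
      have : Integrable g (Measure.map (r 0) ℙ) := by rw [hlaw]; exact hgi
      exact this.comp_measurable (hmeas 0))
    (fun m n hmn => (hindep.indepFun hmn).comp hgc.measurable hgc.measurable)
    (fun n => (hid n).comp hgc.measurable)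
  have hE : ∫ ω, g (r 0 ω) ∂(ℙ : Measure Ω) = ∫ z, g z ∂(mixMeasure (S i) N₀) := by
    rw [← hlaw 0, integral_map (hmeas 0).aemeasurable hgc.aestronglyMeasurable]
  filter_upwards [hslln] with ω hω
  rw [hE] at hω
  filter_upwards [hω.eventually (lt_mem_nhds hgpos), eventually_gt_atTop 0] with N hN hN0
  have hN0' : (0 : ℝ) < N := by exact_mod_cast hN0
  have := (div_pos_iff_of_pos_right hN0').1 hN
  simp only [hg, Finset.sum_sub_distrib] at this
  linarith
end
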